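/- Let a ∈ H^∞ be outer. The norm of the shift S_{\bar{a}} : f ↦ zf on M(\bar{a}) equals ‖a‖_{H^2}/|a(0)| = (1/|a(0)|)·(∫₀^{2π} |a(e^{iθ})|² dθ/2π)^{1/2}. -/

import Mathlib

open Complex Set

noncomputable section

/-- The open unit disk in `ℂ`. -/
def unitDisk : Set ℂ := Metric.ball 0 1

/-- The `n`-th Taylor coefficient of `f` at `0`. -/
def coef (f : ℂ → ℂ) (n : ℕ) : ℂ := iteratedDeriv n f 0 / (n.factorial : ℂ)

/-- `f` belongs to the Hardy space `H²` of the unit disk. -/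
def MemH2 (f : ℂ → ℂ) : Prop :=
  DifferentiableOn ℂ f unitDisk ∧ Summable fun n => ‖coef f n‖ ^ 2

/-- The `H²` norm. -/
def norm2 (f : ℂ → ℂ) : ℝ := Real.sqrt (∑' n, ‖coef f n‖ ^ 2)

/-- The `H²` inner product. -/
def inner2 (f g : ℂ → ℂ) : ℂ := ∑' n, coef f n * (starRingEnd ℂ) (coef g n)

/-- `f` belongs to `H^∞`: bounded and analytic on the unit disk. -/
def MemHinf (f : ℂ → ℂ) : Prop :=
  DifferentiableOn ℂ f unitDisk ∧ ∃ C, ∀ z ∈ unitDisk, ‖f z‖ ≤ C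

/-- The `H^∞` (sup) norm. -/
def normInf (f : ℂ → ℂ) : ℝ := sSup ((fun z => ‖f z‖) '' unitDisk)

/-- The co-analytic Toeplitz operator `T_{\bar a}` in terms of Taylor
coefficients: the `n`-th coefficient of `T_{\bar a} f` is
`∑ₖ conj (â k) * f̂ (n + k)`. -/
def Tbar (a f : ℂ → ℂ) : ℂ → ℂ :=
  fun z => ∑' n : ℕ, (∑' k : ℕ, (starRingEnd ℂ) (coef a k) * coef f (n + k)) * z ^ n

/-- Membership in the range space `M(ā) = T_{\bar a} H²` (as functions on the disk). -/
def MemMbar (a g : ℂ → ℂ) : Prop :=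
  ∃ f, MemH2 f ∧ Set.EqOn g (Tbar a f) unitDisk

/-- The range norm on `M(ā)`: `‖T_{\bar a} f‖_{ā} = ‖f‖_{H²}`. -/
def normMbar (a g : ℂ → ℂ) : ℝ :=
  sInf {r | ∃ f, MemH2 f ∧ Set.EqOn g (Tbar a f) unitDisk ∧ r = norm2 f}

/-- `a` is outer: the analytic Toeplitz operator `T_a` (multiplication by `a`)
has dense range in `H²`. -/
def Outer (a : ℂ → ℂ) : Prop :=
  ∀ g, MemH2 g → ∀ ε > 0, ∃ f, MemH2 f ∧ norm2 (fun z => g z - a z * f z) < ε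

/-- `u` is inner: multiplication by `u` is isometric on `H²`. -/
def IsInner (u : ℂ → ℂ) : Prop :=
  MemHinf u ∧ ∀ f, MemH2 f → norm2 (fun z => u z * f z) = norm2 f

/-- `p` is (given by) a polynomial of degree `< N`, i.e. of degree at most `N - 1`. -/
def MemPoly (N : ℕ) (p : ℂ → ℂ) : Prop :=
  ∃ q : Polynomial ℂ, q.degree < (N : WithBot ℕ) ∧ ∀ z, p z = q.eval z

/-- `φ` is a multiplier from `M(ā₁)` to `M(ā₂)`. -/
def Mult (a₁ a₂ φ : ℂ → ℂ) : Prop :=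
  DifferentiableOn ℂ φ unitDisk ∧
    ∀ f, MemMbar a₁ f → MemMbar a₂ fun z => φ z * f z

/-- The backward shift `B f = (f - f 0) / z`. -/
def Bshift (f : ℂ → ℂ) : ℂ → ℂ :=
  fun z => if z = 0 then deriv f 0 else (f z - f 0) / z

lemma hasSum_coef {f : ℂ → ℂ} (hf : DifferentiableOn ℂ f unitDisk) {z : ℂ} (hz : z ∈ unitDisk) :
    HasSum (fun n => coef f n * z ^ n) (f z) := by
  refine HasSum.congr_fun (hasSum_taylorSeries_on_ball hf hz) fun n => ?_
  simp only [coef, sub_zero, smul_eq_mul]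
  ring

lemma hasFPowerSeriesOnBall_ofScalars {f : ℂ → ℂ} {c : ℕ → ℂ}
    (h : ∀ z ∈ unitDisk, HasSum (fun n => c n * z ^ n) (f z)) :
    HasFPowerSeriesOnBall f (FormalMultilinearSeries.ofScalars ℂ c) 0 1 where
  r_le := by
    refine ENNReal.le_of_forall_nnreal_lt fun r hr => ?_
    have hr' : (r : ℝ) < 1 := by exact_mod_cast hr
    refine FormalMultilinearSeries.le_radius_of_summable _ ?_
    have := (h (r : ℝ) (by simpa [unitDisk] using hr')).summable.norm
    simpa [FormalMultilinearSeries.ofScalars_norm] using this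
  r_pos := by simp
  hasSum := by
    intro y hy
    have hy' : y ∈ unitDisk := by
      rw [← ENNReal.ofReal_one, Metric.eball_ofReal] at hy
      exact hy
    simpa [FormalMultilinearSeries.ofScalars_apply_eq, smul_eq_mul, mul_comm] using h y hy'

lemma coef_eq_of_hasSum {f : ℂ → ℂ} {c : ℕ → ℂ}
    (h : ∀ z ∈ unitDisk, HasSum (fun n => c n * z ^ n) (f z)) : coef f = c := by
  funext n
  have := (hasFPowerSeriesOnBall_ofScalars h).factorial_smul 1 n
  rw [← iteratedDeriv_eq_iteratedFDeriv] at this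
  simp only [FormalMultilinearSeries.ofScalars_apply_eq, one_pow, smul_eq_mul, mul_one,
    nsmul_eq_mul] at this
  rw [coef, ← this, mul_div_cancel_left₀ _ (Nat.cast_ne_zero.2 n.factorial_ne_zero)]

lemma differentiableOn_of_hasSum {f : ℂ → ℂ} {c : ℕ → ℂ}
    (h : ∀ z ∈ unitDisk, HasSum (fun n => c n * z ^ n) (f z)) : DifferentiableOn ℂ f unitDisk := by
  have := (hasFPowerSeriesOnBall_ofScalars h).differentiableOn
  rwa [← ENNReal.ofReal_one, Metric.eball_ofReal] at this

lemma Orthonormal.hasSum_norm_sq {E : Type*} [NormedAddCommGroup E] [InnerProductSpace ℂ E]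
    {v : ℕ → E} (hv : Orthonormal ℂ v) {c : ℕ → ℂ} {u : E} (h : HasSum (fun n => c n • v n) u) :
    HasSum (fun n => ‖c n‖ ^ 2) (‖u‖ ^ 2) := by
  refine (h.norm.pow 2).congr fun s => ?_
  have := hv.inner_sum c c s
  have h2 := @inner_self_eq_norm_sq_to_K ℂ E _ _ _ (∑ i ∈ s, c i • v i)
  rw [this] at h2
  have h3 : ((∑ i ∈ s, ‖c i‖ ^ 2 : ℝ) : ℂ) = ((‖∑ i ∈ s, c i • v i‖ ^ 2 : ℝ) : ℂ) := by
    push_cast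
    refine .trans ?_ h2
    refine Finset.sum_congr rfl fun i _ => ?_
    rw [← Complex.conj_mul']
  exact (Complex.ofReal_injective h3).symm

open AddCircle in
lemma mul_toCircle_mem_unitDisk {r : ℝ} (hr0 : 0 ≤ r) (hr : r < 1) (t : AddCircle (1 : ℝ)) :
    (r * toCircle t : ℂ) ∈ unitDisk := by
  rwa [unitDisk, mem_ball_zero_iff, norm_mul, Circle.norm_coe, mul_one, Complex.norm_real,
    Real.norm_of_nonneg hr0]

open AddCircle in
/-- Parseval's identity on the circle of radius `r < 1`. -/
lemma exists_toLp_of_differentiableOn {f : ℂ → ℂ} (hf : DifferentiableOn ℂ f unitDisk) {r : ℝ}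
    (hr0 : 0 ≤ r) (hr : r < 1) :
    ∃ u : MeasureTheory.Lp ℂ 2 (@haarAddCircle 1 _),
      (∀ᵐ t ∂(@haarAddCircle 1 _), u t = f (r * toCircle t)) ∧
      HasSum (fun n => ‖coef f n‖ ^ 2 * r ^ (2 * n)) (‖u‖ ^ 2) := by
  have hmem := mul_toCircle_mem_unitDisk hr0 hr
  have hmem0 : (r : ℂ) ∈ unitDisk := by simpa [unitDisk, abs_of_nonneg hr0] using hr
  have hcont : Continuous fun t : AddCircle (1 : ℝ) => f (r * toCircle t) :=
    hf.continuousOn.comp_continuous (by fun_prop) hmem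
  let F : C(AddCircle (1 : ℝ), ℂ) := ⟨_, hcont⟩
  have hs : Summable fun n : ℕ => (coef f n * (r : ℂ) ^ n) • fourier (T := 1) (n : ℤ) := by
    refine Summable.of_norm ?_
    simpa only [norm_smul, fourier_norm, mul_one] using (hasSum_coef hf hmem0).summable.norm
  have hF : HasSum (fun n : ℕ => (coef f n * (r : ℂ) ^ n) • fourier (T := 1) (n : ℤ)) F := by
    convert hs.hasSum
    ext t
    rw [← ContinuousMap.tsum_apply hs]
    refine (hasSum_coef hf (hmem t)).tsum_eq.symm.trans (tsum_congr fun n => ?_)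
    simp [fourier_apply, toCircle_nsmul, mul_pow, mul_assoc]
  refine ⟨F.toLp 2 _ ℂ, ContinuousMap.coeFn_toLp _ F, ?_⟩
  have hv := (@orthonormal_fourier 1 _).comp (fun n : ℕ => (n : ℤ)) Nat.cast_injective
  have h2 := hF.mapL (ContinuousMap.toLp 2 (@haarAddCircle 1 _) ℂ)
  simp only [map_smul] at h2
  convert hv.hasSum_norm_sq h2 using 2 with n
  rw [norm_mul, norm_pow, mul_pow, ← pow_mul, Complex.norm_real, Real.norm_of_nonneg hr0,
    mul_comm n]

lemma sum_coef_sq_le {f g : ℂ → ℂ} {C : ℝ} (hf : DifferentiableOn ℂ f unitDisk)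
    (hg : MemH2 g) (hfg : ∀ z ∈ unitDisk, ‖f z‖ ≤ C * ‖g z‖) (s : Finset ℕ) :
    ∑ n ∈ s, ‖coef f n‖ ^ 2 ≤ (C * norm2 g) ^ 2 := by
  have key (r : ℝ) (hr : r ∈ Ico (0 : ℝ) 1) :
      ∑ n ∈ s, ‖coef f n‖ ^ 2 * r ^ (2 * n) ≤ (C * norm2 g) ^ 2 := by
    obtain ⟨u, hu, hus⟩ := exists_toLp_of_differentiableOn hf hr.1 hr.2
    obtain ⟨v, hv, hvs⟩ := exists_toLp_of_differentiableOn hg.1 hr.1 hr.2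
    have huv : ‖u‖ ≤ C * ‖v‖ := by
      refine MeasureTheory.Lp.norm_le_mul_norm_of_ae_le_mul ?_
      filter_upwards [hu, hv] with t h1 h2
      rw [h1, h2]
      exact hfg _ (mul_toCircle_mem_unitDisk hr.1 hr.2 t)
    have hvg : ‖v‖ ^ 2 ≤ norm2 g ^ 2 := by
      rw [norm2, Real.sq_sqrt (by positivity)]
      refine hasSum_le (fun n => ?_) hvs hg.2.hasSum
      exact mul_le_of_le_one_right (by positivity) (pow_le_one₀ hr.1 hr.2.le)
    calc ∑ n ∈ s, ‖coef f n‖ ^ 2 * r ^ (2 * n) ≤ ‖u‖ ^ 2 :=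
          sum_le_hasSum s (fun n _ => mul_nonneg (by positivity) (pow_nonneg hr.1 _)) hus
      _ ≤ (C * ‖v‖) ^ 2 := by gcongr
      _ ≤ (C * norm2 g) ^ 2 := by rw [mul_pow, mul_pow]; gcongr
  have hlim : Filter.Tendsto (fun r : ℝ => ∑ n ∈ s, ‖coef f n‖ ^ 2 * r ^ (2 * n))
      (nhdsWithin 1 (Iio 1)) (nhds (∑ n ∈ s, ‖coef f n‖ ^ 2)) := by
    have : Continuous fun r : ℝ => ∑ n ∈ s, ‖coef f n‖ ^ 2 * r ^ (2 * n) := by fun_prop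
    simpa using (this.tendsto 1).mono_left nhdsWithin_le_nhds
  refine le_of_tendsto hlim ?_
  filter_upwards [Ico_mem_nhdsLT (zero_lt_one' ℝ)] with r hr using key r hr

/-- An analytic function dominated on the disk by a multiple of an `H²` function is in `H²`. -/
lemma MemH2.of_norm_le {f g : ℂ → ℂ} {C : ℝ} (hC : 0 ≤ C) (hf : DifferentiableOn ℂ f unitDisk)
    (hg : MemH2 g) (hfg : ∀ z ∈ unitDisk, ‖f z‖ ≤ C * ‖g z‖) :
    MemH2 f ∧ norm2 f ≤ C * norm2 g := by
  have h := sum_coef_sq_le hf hg hfg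
  refine ⟨⟨hf, summable_of_sum_le (fun _ => by positivity) h⟩, ?_⟩
  refine Real.sqrt_le_iff.2 ⟨mul_nonneg hC (Real.sqrt_nonneg _), ?_⟩
  exact Real.tsum_le_of_sum_le (fun _ => by positivity) h

/-- The sequence space `ℓ²`, identified with `H²` through Taylor coefficients. -/
abbrev EllTwo : Type := lp (fun _ : ℕ => ℂ) 2

lemma EllTwo.norm_sq (v : EllTwo) : ‖v‖ ^ 2 = ∑' n, ‖v n‖ ^ 2 := by
  simpa using lp.norm_rpow_eq_tsum (p := 2) (by simp) v

lemma EllTwo.summable_norm_sq (v : EllTwo) : Summable fun n => ‖v n‖ ^ 2 := by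
  simpa using (lp.memℓp v).summable (by simp)

/-- The element of `ℓ²` with the given square-summable coordinates. -/
def EllTwo.mk (c : ℕ → ℂ) (hc : Summable fun n => ‖c n‖ ^ 2) : EllTwo :=
  ⟨c, memℓp_gen (by simpa using hc)⟩

/-- The Taylor coefficients of an `H²` function, as an element of `ℓ²`. -/
def coefVec (f : ℂ → ℂ) (hf : MemH2 f) : EllTwo := .mk (coef f) hf.2

lemma coefVec_apply {f : ℂ → ℂ} (hf : MemH2 f) (n : ℕ) : coefVec f hf n = coef f n := rfl

lemma norm_coefVec {f : ℂ → ℂ} (hf : MemH2 f) : ‖coefVec f hf‖ = norm2 f := by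
  rw [norm2, ← Real.sqrt_sq (norm_nonneg (coefVec f hf)), EllTwo.norm_sq]
  rfl

lemma hasSum_powerSeries_of_bounded {c : ℕ → ℂ} {C : ℝ} (hc : ∀ n, ‖c n‖ ≤ C) {z : ℂ}
    (hz : z ∈ unitDisk) : HasSum (fun n => c n * z ^ n) (∑' n, c n * z ^ n) := by
  rw [unitDisk, mem_ball_zero_iff] at hz
  refine (Summable.of_norm_bounded
    ((summable_geometric_of_lt_one (norm_nonneg z) hz).mul_left C) fun n => ?_).hasSum
  rw [norm_mul, norm_pow]
  gcongr
  exact hc n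

/-- The `H²` function with Taylor coefficients `v`. -/
def powerSum (v : EllTwo) : ℂ → ℂ := fun z => ∑' n, v n * z ^ n

lemma hasSum_powerSum (v : EllTwo) {z : ℂ} (hz : z ∈ unitDisk) :
    HasSum (fun n => v n * z ^ n) (powerSum v z) :=
  hasSum_powerSeries_of_bounded (lp.norm_apply_le_norm (by simp) v) hz

lemma coef_powerSum (v : EllTwo) : coef (powerSum v) = v :=
  coef_eq_of_hasSum fun _ => hasSum_powerSum v

lemma memH2_powerSum (v : EllTwo) : MemH2 (powerSum v) :=
  ⟨differentiableOn_of_hasSum fun _ => hasSum_powerSum v, by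
    rw [coef_powerSum]; exact v.summable_norm_sq⟩

lemma coefVec_powerSum (v : EllTwo) : coefVec (powerSum v) (memH2_powerSum v) = v :=
  lp.ext (coef_powerSum v)

lemma coef_mul {f g : ℂ → ℂ} (hf : DifferentiableOn ℂ f unitDisk)
    (hg : DifferentiableOn ℂ g unitDisk) (n : ℕ) :
    coef (fun z => f z * g z) n = ∑ p ∈ Finset.HasAntidiagonal.antidiagonal n, coef f p.1 * coef g p.2 := by
  refine congrFun (coef_eq_of_hasSum
    (c := fun n => ∑ p ∈ Finset.HasAntidiagonal.antidiagonal n, coef f p.1 * coef g p.2) fun z hz => ?_) n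
  have h1 := hasSum_coef hf hz
  have h2 := hasSum_coef hg hz
  have h3 := (summable_norm_sum_mul_antidiagonal_of_summable_norm h1.summable.norm
    h2.summable.norm).of_norm.hasSum
  rw [← tsum_mul_tsum_eq_tsum_sum_antidiagonal_of_summable_norm h1.summable.norm
    h2.summable.norm, h1.tsum_eq, h2.tsum_eq] at h3
  refine HasSum.congr_fun h3 fun n => ?_
  rw [Finset.sum_mul]
  refine Finset.sum_congr rfl fun p hp => ?_
  rw [← Finset.HasAntidiagonal.mem_antidiagonal.1 hp, pow_add]
  ring

lemma MemHinf.exists_nonneg_bound {a : ℂ → ℂ} (ha : MemHinf a) :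
    ∃ C, 0 ≤ C ∧ ∀ z ∈ unitDisk, ‖a z‖ ≤ C := by
  obtain ⟨C, hC⟩ := ha.2
  exact ⟨C, (norm_nonneg _).trans (hC 0 (by simp [unitDisk])), hC⟩

lemma exists_mul_bound {a : ℂ → ℂ} (ha : MemHinf a) :
    ∃ C, ∀ f, MemH2 f → MemH2 (fun z => a z * f z) ∧ norm2 (fun z => a z * f z) ≤ C * norm2 f := by
  obtain ⟨C, hC0, hC⟩ := ha.exists_nonneg_bound
  refine ⟨C, fun f hf => MemH2.of_norm_le hC0 (ha.1.mul hf.1) hf fun z hz => ?_⟩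
  rw [norm_mul]
  gcongr
  exact hC z hz

lemma MemHinf.memH2_mul {a f : ℂ → ℂ} (ha : MemHinf a) (hf : MemH2 f) :
    MemH2 fun z => a z * f z :=
  ((exists_mul_bound ha).choose_spec f hf).1

lemma MemHinf.memH2 {a : ℂ → ℂ} (ha : MemHinf a) : MemH2 a := by
  obtain ⟨C, hC0, hC⟩ := ha.exists_nonneg_bound
  have h1 : ∀ z ∈ unitDisk, powerSum (lp.single 2 0 1) z = 1 := fun z hz => by
    refine (hasSum_powerSum _ hz).unique ?_
    convert hasSum_single (f := fun n => (lp.single 2 0 1 : EllTwo) n * z ^ n) 0 ?_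
    · simp
    · intro n hn
      simp [hn]
  refine (MemH2.of_norm_le hC0 ha.1 (memH2_powerSum (lp.single 2 0 1)) fun z hz => ?_).1
  rw [h1 z hz, norm_one, mul_one]
  exact hC z hz

/-- The analytic Toeplitz operator `T_a` on `ℓ²`. -/
def mulOp (a : ℂ → ℂ) (ha : MemHinf a) : EllTwo →L[ℂ] EllTwo :=
  LinearMap.mkContinuous
    { toFun := fun v => coefVec _ (ha.memH2_mul (memH2_powerSum v))
      map_add' := fun v w => by
        ext n
        simp [coefVec_apply, coef_mul ha.1 (memH2_powerSum _).1, coef_powerSum, mul_add,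
          Finset.sum_add_distrib]
      map_smul' := fun c v => by
        ext n
        simp [coefVec_apply, coef_mul ha.1 (memH2_powerSum _).1, coef_powerSum, mul_left_comm _ c,
          Finset.mul_sum] }
    (exists_mul_bound ha).choose fun v => by
      have := ((exists_mul_bound ha).choose_spec _ (memH2_powerSum v)).2
      rwa [← norm_coefVec (memH2_powerSum v), coefVec_powerSum,
        ← norm_coefVec (ha.memH2_mul (memH2_powerSum v))] at this

lemma mulOp_apply {a : ℂ → ℂ} (ha : MemHinf a) (v : EllTwo) (n : ℕ) :
    mulOp a ha v n = ∑ p ∈ Finset.HasAntidiagonal.antidiagonal n, coef a p.1 * v p.2 := by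
  rw [← coef_powerSum v, ← coef_mul ha.1 (memH2_powerSum v).1]
  rfl

lemma mulOp_single_add {a : ℂ → ℂ} (ha : MemHinf a) (n k : ℕ) :
    mulOp a ha (lp.single 2 n 1) (n + k) = coef a k := by
  rw [mulOp_apply, Finset.sum_eq_single (k, n)]
  · simp
  · rintro ⟨i, j⟩ hij hne
    have : j ≠ n := by
      rintro rfl
      exact hne (by simpa [add_comm j] using hij)
    simp [this]
  · intro h
    exact absurd (by simp [add_comm]) h

lemma mulOp_single_of_lt {a : ℂ → ℂ} (ha : MemHinf a) {n m : ℕ} (h : m < n) :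
    mulOp a ha (lp.single 2 n 1) m = 0 := by
  rw [mulOp_apply]
  refine Finset.sum_eq_zero fun p hp => ?_
  have : p.2 ≠ n := by have := Finset.HasAntidiagonal.mem_antidiagonal.1 hp; omega
  simp [this]

/-- The `n`-th power of the backward shift on `ℓ²`. -/
def leftShift (n : ℕ) (v : EllTwo) : EllTwo :=
  .mk (fun k => v (n + k)) (v.summable_norm_sq.comp_injective (add_right_injective n))

lemma leftShift_apply (n : ℕ) (v : EllTwo) (k : ℕ) : leftShift n v k = v (n + k) := rfl

lemma norm_leftShift_le (n : ℕ) (v : EllTwo) : ‖leftShift n v‖ ≤ ‖v‖ := by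
  refine pow_le_pow_iff_left₀ (norm_nonneg _) (norm_nonneg _) two_ne_zero |>.1 ?_
  rw [EllTwo.norm_sq, EllTwo.norm_sq]
  exact tsum_comp_le_tsum_of_inj v.summable_norm_sq (fun _ => by positivity)
    (add_right_injective n)

lemma norm_sq_eq_add_leftShift (v : EllTwo) : ‖v‖ ^ 2 = ‖v 0‖ ^ 2 + ‖leftShift 1 v‖ ^ 2 := by
  rw [EllTwo.norm_sq, EllTwo.norm_sq, v.summable_norm_sq.tsum_eq_zero_add]
  simp only [leftShift_apply, add_comm 1]

/-- The Taylor coefficients of `T_{\bar a} f`. -/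
def toepCoef (α x : ℕ → ℂ) (n : ℕ) : ℂ := ∑' k, (starRingEnd ℂ) (α k) * x (n + k)

lemma toepCoef_eq_inner (v w : EllTwo) (n : ℕ) :
    toepCoef v w n = inner ℂ v (leftShift n w) := by
  rw [lp.inner_eq_tsum]
  simp [toepCoef, leftShift_apply, mul_comm]

lemma norm_toepCoef_le (v w : EllTwo) (n : ℕ) : ‖toepCoef v w n‖ ≤ ‖v‖ * ‖w‖ := by
  rw [toepCoef_eq_inner]
  exact (norm_inner_le_norm _ _).trans (by gcongr; exact norm_leftShift_le n w)

lemma inner_mulOp_single {a : ℂ → ℂ} (ha : MemHinf a) (v : EllTwo) (n : ℕ) :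
    inner ℂ (mulOp a ha (lp.single 2 n 1)) v = toepCoef (coef a) v n := by
  refine (lp.hasSum_inner _ v).unique ?_
  rw [← (add_right_injective n).hasSum_iff]
  · have h : HasSum _ (inner ℂ (coefVec a ha.memH2) (leftShift n v)) := lp.hasSum_inner _ _
    rw [← toepCoef_eq_inner] at h
    refine HasSum.congr_fun h fun k => ?_
    simp [mulOp_single_add, leftShift_apply, coefVec_apply]
  · intro m hm
    have : m < n := by
      by_contra! h
      exact hm ⟨m - n, by simp [h]⟩
    simp [mulOp_single_of_lt ha this]

lemma hasSum_Tbar {a f : ℂ → ℂ} (ha : MemH2 a) (hf : MemH2 f) {z : ℂ} (hz : z ∈ unitDisk) :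
    HasSum (fun n => toepCoef (coef a) (coef f) n * z ^ n) (Tbar a f z) :=
  hasSum_powerSeries_of_bounded (norm_toepCoef_le (coefVec a ha) (coefVec f hf)) hz

lemma norm2_sub_mul {a f g : ℂ → ℂ} (ha : MemHinf a) (hf : MemH2 f) (hg : MemH2 g) :
    norm2 (fun z => g z - a z * f z) = ‖coefVec g hg - mulOp a ha (coefVec f hf)‖ := by
  have h : coef (fun z => g z - a z * f z) = ⇑(coefVec g hg - mulOp a ha (coefVec f hf)) := by
    refine coef_eq_of_hasSum fun z hz => ?_
    refine HasSum.congr_fun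
      ((hasSum_coef hg.1 hz).sub (hasSum_coef (ha.1.mul hf.1) hz)) fun n => ?_
    rw [← sub_mul]
    congr 1
    rw [lp.coeFn_sub, Pi.sub_apply, mulOp_apply]
    exact congrArg _ (coef_mul ha.1 hf.1 n).symm
  rw [norm2, h, ← EllTwo.norm_sq, Real.sqrt_sq (norm_nonneg _)]

lemma Outer.denseRange_mulOp {a : ℂ → ℂ} (hao : Outer a) (ha : MemHinf a) :
    DenseRange (mulOp a ha) := by
  refine Metric.denseRange_iff.2 fun v ε hε => ?_
  obtain ⟨f, hf, h⟩ := hao _ (memH2_powerSum v) ε hε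
  rw [norm2_sub_mul ha hf (memH2_powerSum v), coefVec_powerSum] at h
  exact ⟨_, by rwa [dist_eq_norm]⟩

lemma Outer.coef_zero_ne_zero {a : ℂ → ℂ} (hao : Outer a) (ha : MemHinf a) : coef a 0 ≠ 0 := by
  intro h0
  obtain ⟨v, hv⟩ := Metric.denseRange_iff.1 (hao.denseRange_mulOp ha) (lp.single 2 0 1) 1 one_pos
  have := lp.norm_apply_le_norm two_ne_zero ((lp.single 2 0 1 : EllTwo) - mulOp a ha v) 0
  rw [lp.coeFn_sub, Pi.sub_apply, mulOp_apply] at this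
  simp only [Finset.Nat.antidiagonal_zero, Finset.sum_singleton, h0, lp.single_apply_self, zero_mul,
    sub_zero, norm_one] at this
  rw [dist_eq_norm] at hv
  linarith

/-- For outer `a`, the co-analytic Toeplitz operator `T_{\bar a}` is injective. -/
lemma Outer.toepCoef_injective {a : ℂ → ℂ} (hao : Outer a) (ha : MemHinf a) {v w : EllTwo}
    (h : toepCoef (coef a) v = toepCoef (coef a) w) : v = w := by
  have h1 : (innerSL ℂ v).comp (mulOp a ha) = (innerSL ℂ w).comp (mulOp a ha) := by
    refine lp.ext_continuousLinearMap (by simp) fun n => ?_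
    refine ContinuousLinearMap.ext_ring ?_
    have := congrFun h n
    rw [← inner_mulOp_single ha, ← inner_mulOp_single ha] at this
    simpa using congrArg (starRingEnd ℂ) this
  refine ext_inner_right ℂ fun u => ?_
  refine congrFun ((hao.denseRange_mulOp ha).equalizer (innerSL ℂ v).continuous
    (innerSL ℂ w).continuous (funext fun x => ?_)) u
  exact DFunLike.congr_fun h1 x

lemma Outer.normMbar_eq {a f g : ℂ → ℂ} (hao : Outer a) (ha : MemHinf a) (hf : MemH2 f)
    (hg : EqOn g (Tbar a f) unitDisk) : normMbar a g = norm2 f := by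
  have : {r | ∃ f, MemH2 f ∧ EqOn g (Tbar a f) unitDisk ∧ r = norm2 f} = {norm2 f} := by
    refine Subset.antisymm ?_ (singleton_subset_iff.2 ⟨f, hf, hg, rfl⟩)
    rintro _ ⟨f', hf', hg', rfl⟩
    have h : toepCoef (coef a) (coef f') = toepCoef (coef a) (coef f) :=
      (coef_eq_of_hasSum fun _ => hasSum_Tbar ha.memH2 hf').symm.trans <|
        coef_eq_of_hasSum fun z hz => by
          rw [← hg' hz, hg hz]
          exact hasSum_Tbar ha.memH2 hf hz
    have h2 : coefVec f' hf' = coefVec f hf := hao.toepCoef_injective ha h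
    rw [mem_singleton_iff, ← norm_coefVec hf', h2, norm_coefVec]
  rw [normMbar, this, csInf_singleton]

/-- Multiplication by `z` on `M(\bar a)`, lifted to `H²`. -/
lemma exists_shift_lift {a f : ℂ → ℂ} (ha : MemH2 a) (ha0 : coef a 0 ≠ 0) (hf : MemH2 f) :
    ∃ g, MemH2 g ∧ (∀ z ∈ unitDisk, z * Tbar a f z = Tbar a g z) ∧
      norm2 g ^ 2 = (‖inner ℂ (leftShift 1 (coefVec a ha)) (coefVec f hf)‖ / ‖coef a 0‖) ^ 2 +
        norm2 f ^ 2 := by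
  set I := inner ℂ (leftShift 1 (coefVec a ha)) (coefVec f hf)
  set c : ℕ → ℂ := fun n => Nat.casesOn n (-I / (starRingEnd ℂ) (coef a 0)) (coef f) with hc
  have hcs : Summable fun n => ‖c n‖ ^ 2 := (summable_nat_add_iff 1).1 hf.2
  set v : EllTwo := .mk c hcs
  have hv1 : leftShift 1 v = coefVec f hf := lp.ext <| funext fun n => by
    rw [leftShift_apply, add_comm]; rfl
  have hcv : coef (powerSum v) = c := coef_powerSum v
  have hsucc (n : ℕ) : toepCoef (coef a) c (n + 1) = toepCoef (coef a) (coef f) n := by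
    refine tsum_congr fun k => ?_
    rw [show n + 1 + k = n + k + 1 by ring]
  have hzero : toepCoef (coef a) c 0 = 0 := by
    have h1 : HasSum (fun k => inner ℂ (coef a k) (c k)) (inner ℂ (coefVec a ha) v) :=
      lp.hasSum_inner _ _
    have h2 : HasSum (fun k => inner ℂ (coef a (1 + k)) (coef f k)) I := lp.hasSum_inner _ _
    have h3 : toepCoef (coef a) c 0 = ∑' k, inner ℂ (coef a k) (c k) :=
      tsum_congr fun k => by simp [mul_comm]
    have h4 : ∑' k, inner ℂ (coef a (k + 1)) (c (k + 1)) = I := by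
      rw [← h2.tsum_eq]
      exact tsum_congr fun k => by rw [add_comm 1]
    rw [h3, h1.summable.tsum_eq_zero_add, h4]
    have : (starRingEnd ℂ) (coef a 0) ≠ 0 := by simpa using ha0
    simp [hc, this]
  refine ⟨powerSum v, memH2_powerSum v, fun z hz => ?_, ?_⟩
  · have h1 := hasSum_Tbar ha (memH2_powerSum v) hz
    have h2 := hasSum_Tbar ha hf hz
    rw [hcv] at h1
    rw [← h1.tsum_eq, h1.summable.tsum_eq_zero_add, hzero, ← h2.tsum_eq, ← tsum_mul_left]
    simp only [hsucc, zero_mul, zero_add, pow_succ]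
    exact tsum_congr fun n => by ring
  · rw [← norm_coefVec (memH2_powerSum v), coefVec_powerSum, norm_sq_eq_add_leftShift, hv1,
      norm_coefVec]
    congr 2
    change ‖-I / (starRingEnd ℂ) (coef a 0)‖ = _
    simp

lemma exists_norm_inner_eq (u : EllTwo) : ∃ v : EllTwo, v ≠ 0 ∧ ‖inner ℂ u v‖ = ‖u‖ * ‖v‖ := by
  by_cases hu : u = 0
  · refine ⟨lp.single 2 0 1, fun h => ?_, by simp [hu]⟩
    simpa using congrArg (fun w : EllTwo => w 0) h
  · exact ⟨u, hu, by rw [inner_self_eq_norm_sq_to_K]; simp [sq]⟩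

/-- for outer `a ∈ H^∞`, the shift `S_{ā} : f ↦ z f` maps `M(ā)`
into itself and its norm equals `‖a‖_{H²} / |a 0|`. -/
theorem stmt18 (a : ℂ → ℂ) (ha : MemHinf a) (hao : Outer a) :
    (∀ f, MemMbar a f → MemMbar a fun z => z * f z) ∧
      (∀ f, MemMbar a f →
        normMbar a (fun z => z * f z) ≤ (norm2 a / ‖a 0‖) * normMbar a f) ∧
      ∃ f, MemMbar a f ∧ normMbar a f ≠ 0 ∧
        normMbar a (fun z => z * f z) = (norm2 a / ‖a 0‖) * normMbar a f := by
  have ha0 := hao.coef_zero_ne_zero ha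
  have ha0' : coef a 0 = a 0 := by simp [coef]
  have hpos : 0 < ‖a 0‖ := by rw [← ha0']; exact norm_pos_iff.2 ha0
  have hnorm : norm2 a ^ 2 = ‖a 0‖ ^ 2 + ‖leftShift 1 (coefVec a ha.memH2)‖ ^ 2 := by
    rw [← norm_coefVec ha.memH2, norm_sq_eq_add_leftShift, coefVec_apply, ha0']
  have hnonneg (f : ℂ → ℂ) : 0 ≤ norm2 f := Real.sqrt_nonneg _
  have hsq (x : ℝ) : (‖leftShift 1 (coefVec a ha.memH2)‖ * x / ‖a 0‖) ^ 2 + x ^ 2 =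
      (norm2 a / ‖a 0‖ * x) ^ 2 := by
    rw [mul_pow, div_pow, div_pow, hnorm]
    field_simp
    ring
  refine ⟨?_, ?_, ?_⟩
  · rintro f ⟨h, hh, hfh⟩
    obtain ⟨g, hg, hgz, -⟩ := exists_shift_lift ha.memH2 ha0 hh
    exact ⟨g, hg, fun z hz => by simp only [hfh hz, hgz z hz]⟩
  · rintro f ⟨h, hh, hfh⟩
    obtain ⟨g, hg, hgz, hgn⟩ := exists_shift_lift ha.memH2 ha0 hh
    rw [hao.normMbar_eq ha hh hfh,
      hao.normMbar_eq ha hg fun z hz => by simp only [hfh hz, hgz z hz]]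
    refine pow_le_pow_iff_left₀ (hnonneg g)
      (mul_nonneg (div_nonneg (hnonneg a) hpos.le) (hnonneg h)) two_ne_zero |>.1 ?_
    rw [hgn, ha0', ← hsq, ← norm_coefVec hh]
    gcongr
    exact norm_inner_le_norm _ _
  · obtain ⟨v, hv0, hv⟩ := exists_norm_inner_eq (leftShift 1 (coefVec a ha.memH2))
    have hh := memH2_powerSum v
    have hvn : norm2 (powerSum v) = ‖v‖ := by rw [← norm_coefVec hh, coefVec_powerSum]
    obtain ⟨g, hg, hgz, hgn⟩ := exists_shift_lift ha.memH2 ha0 hh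
    rw [coefVec_powerSum, hv, hvn, ha0', hsq] at hgn
    have hf := hao.normMbar_eq ha hh fun _ _ => rfl
    refine ⟨Tbar a (powerSum v), ⟨_, hh, fun _ _ => rfl⟩, ?_, ?_⟩
    · rw [hf, hvn]
      exact norm_ne_zero_iff.2 hv0
    · rw [hf, hvn, hao.normMbar_eq ha hg hgz]
      exact (pow_left_inj₀ (hnonneg g)
        (mul_nonneg (div_nonneg (hnonneg a) hpos.le) (norm_nonneg v)) two_ne_zero).1 hgn
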